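/- arXiv:2507.08543 — 2 statements merged into one kernel-verified Lean document; each statement's English description precedes it below -/
import Mathlib

section
/- Let X⁽⁰⁾ ∈ D. For each t ≥ 0, set γ_t = 2/(t+2) and M_t = ∇f(X⁽ᵗ⁾); assume σ₁(M_t) > 0 and set δ_t = C_f/(2·(t+2)·σ₁(M_t)). Suppose there exist unit vectors u₁, v₁ ∈ ℝ^d with u₁ᵀM_t v₁ = −σ₁(M_t), and unit vectors u_t, v_t ∈ ℝ^d with ‖u_t − u₁‖₂ ≤ δ_t and ‖v_t − v₁‖₂ ≤ δ_t; set X⁽ᵗ⁺¹⁾ = (1 − γ_t)·X⁽ᵗ⁾ + γ_t·u_t v_tᵀ. Then f(X⁽ᵗ⁾) − f(X*) ≤ 4·C_f/(t+2) for all t ≥ 1. -/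
open scoped RealInnerProductSpace

/-- The largest singular value of a real matrix, i.e. its `ℓ₂ → ℓ₂` operator norm. -/
noncomputable def sigma1 {d : ℕ} (M : Matrix (Fin d) (Fin d) ℝ) : ℝ :=
  ‖Matrix.toEuclideanCLM (𝕜 := ℝ) M‖

/-- View an element of the Euclidean (Frobenius) space `ℝ^{d×d}` as a matrix. -/
def toMat {d : ℕ} (X : EuclideanSpace ℝ (Fin d × Fin d)) :
    Matrix (Fin d) (Fin d) ℝ :=
  Matrix.of fun i j => X (i, j)

/-- The rank-one outer product `u vᵀ` as an element of the Euclidean (Frobenius)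
space `ℝ^{d×d}`. -/
noncomputable def outerEuc {d : ℕ} (u v : EuclideanSpace ℝ (Fin d)) :
    EuclideanSpace ℝ (Fin d × Fin d) :=
  (WithLp.equiv 2 ((Fin d × Fin d) → ℝ)).symm fun p => u p.1 * v p.2

/-- The first-order characterization of convexity: a convex function lies above its tangents. -/
theorem ConvexOn.add_inner_gradient_le {E : Type*} [NormedAddCommGroup E] [InnerProductSpace ℝ E]
    [CompleteSpace E] {f : E → ℝ} {g x : E} (hf : ConvexOn ℝ Set.univ f)
    (hg : HasGradientAt f g x) (y : E) : f x + ⟪y - x, g⟫ ≤ f y := by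
  have hconv : ConvexOn ℝ Set.univ (f ∘ AffineMap.lineMap (k := ℝ) x y) :=
    hf.comp_affineMap (AffineMap.lineMap (k := ℝ) x y)
  have hderiv : HasDerivAt (f ∘ AffineMap.lineMap (k := ℝ) x y) ⟪g, y - x⟫ 0 := by
    have hfd : HasFDerivAt f (InnerProductSpace.toDual ℝ E g)
        (AffineMap.lineMap (k := ℝ) x y (0 : ℝ)) := by
      simpa using hg.hasFDerivAt
    simpa using hfd.comp_hasDerivAt (0 : ℝ) AffineMap.hasDerivAt_lineMap
  have hslope := hconv.le_slope_of_hasDerivAt (Set.mem_univ 0) (Set.mem_univ 1) one_pos hderiv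
  simp only [slope_def_field, Function.comp_apply, AffineMap.lineMap_apply_one,
    AffineMap.lineMap_apply_zero, sub_zero, div_one] at hslope
  rw [real_inner_comm]
  linarith

/-- The Frobenius pairing of `u vᵀ` with `M` is `uᵀ M v`. -/
theorem inner_outerEuc {d : ℕ} (u v : EuclideanSpace ℝ (Fin d))
    (M : EuclideanSpace ℝ (Fin d × Fin d)) :
    ⟪outerEuc u v, M⟫ = ⟪u, Matrix.toEuclideanCLM (𝕜 := ℝ) (toMat M) v⟫ := by
  simp only [PiLp.inner_apply, outerEuc, toMat, Fintype.sum_prod_type, Matrix.ofLp_toEuclideanCLM,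
    Matrix.mulVec, dotProduct, Matrix.of_apply, WithLp.equiv_symm_apply, RCLike.inner_apply,
    conj_trivial, Finset.sum_mul]
  exact Finset.sum_congr rfl fun i _ => Finset.sum_congr rfl fun j _ => by ring

/-- A bilinear form `⟪·, A ·⟫` is Lipschitz in each argument on unit vectors. -/
theorem inner_apply_le_of_unit {E : Type*} [NormedAddCommGroup E] [InnerProductSpace ℝ E]
    (A : E →L[ℝ] E) {u v a b : E} (hv : ‖v‖ = 1) (ha : ‖a‖ = 1) :
    ⟪u, A v⟫ ≤ ⟪a, A b⟫ + ‖A‖ * (‖u - a‖ + ‖v - b‖) := by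
  have hsplit : ⟪u, A v⟫ = ⟪a, A b⟫ + ⟪u - a, A v⟫ + ⟪a, A (v - b)⟫ := by
    simp only [map_sub, inner_sub_left, inner_sub_right]
    ring
  have hleft : ⟪u - a, A v⟫ ≤ ‖u - a‖ * ‖A‖ := by
    have hAv := A.le_opNorm v
    rw [hv, mul_one] at hAv
    exact (real_inner_le_norm _ _).trans (by gcongr)
  have hright : ⟪a, A (v - b)⟫ ≤ ‖A‖ * ‖v - b‖ := by
    have hle := real_inner_le_norm a (A (v - b))
    rw [ha, one_mul] at hle
    exact hle.trans (A.le_opNorm _)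
  linarith

/-- The Frank–Wolfe recursion with step `2 / (t + 2)` gives an `O(1 / t)` rate. -/
theorem le_div_of_frankWolfe_recursion {h : ℕ → ℝ} {C : ℝ} (hC : 0 ≤ C)
    (hrec : ∀ t : ℕ, h (t + 1) ≤ (1 - 2 / ((t : ℝ) + 2)) * h t + C / ((t : ℝ) + 2) ^ 2)
    (t : ℕ) (ht : 1 ≤ t) : h t ≤ C / ((t : ℝ) + 2) := by
  induction t, ht using Nat.le_induction with
  | base =>
    have h1 := hrec 0
    norm_num at h1 ⊢
    linarith
  | succ t _ ih =>
    have hnn : 0 ≤ 1 - 2 / ((t : ℝ) + 2) := by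
      rw [sub_nonneg, div_le_one (by positivity)]
      linarith [t.cast_nonneg (α := ℝ)]
    calc h (t + 1)
        ≤ (1 - 2 / ((t : ℝ) + 2)) * (C / ((t : ℝ) + 2)) + C / ((t : ℝ) + 2) ^ 2 :=
          (hrec t).trans (by gcongr)
      _ = C * (((t : ℝ) + 1) / ((t : ℝ) + 2) ^ 2) := by field_simp; ring
      _ ≤ C * (1 / ((t : ℝ) + 3)) := by
          gcongr C * ?_
          rw [div_le_div_iff₀ (by positivity) (by positivity)]
          nlinarith
      _ = C / (((t + 1 : ℕ) : ℝ) + 2) := by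
          rw [mul_one_div]
          push_cast
          ring

theorem matrix_frank_wolfe_convergence {d : ℕ}
    (f : EuclideanSpace ℝ (Fin d × Fin d) → ℝ)
    (f' : EuclideanSpace ℝ (Fin d × Fin d) → EuclideanSpace ℝ (Fin d × Fin d))
    (D : Set (EuclideanSpace ℝ (Fin d × Fin d)))
    (hDcp : IsCompact D) (hDcv : Convex ℝ D)
    (hDouter : ∀ u v : EuclideanSpace ℝ (Fin d), ‖u‖ = 1 → ‖v‖ = 1 → outerEuc u v ∈ D)
    (hDlb : ∀ S ∈ D, ∀ M : EuclideanSpace ℝ (Fin d × Fin d),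
      -(sigma1 (toMat M)) ≤ ⟪S, M⟫)
    (hconv : ConvexOn ℝ Set.univ f)
    (hgrad : ∀ X, HasGradientAt f (f' X) X)
    (Cf : ℝ) (hCf : 0 < Cf)
    (hcurv : ∀ X ∈ D, ∀ S ∈ D, ∀ β ∈ Set.Icc (0:ℝ) 1,
      f (X + β • (S - X)) ≤ f X + β * ⟪S - X, f' X⟫ + β ^ 2 / 2 * Cf)
    (Xstar : EuclideanSpace ℝ (Fin d × Fin d)) (hXstar : Xstar ∈ D)
    (hmin : ∀ Z ∈ D, f Xstar ≤ f Z)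
    (X : ℕ → EuclideanSpace ℝ (Fin d × Fin d))
    (u v u1 v1 : ℕ → EuclideanSpace ℝ (Fin d))
    (hX0 : X 0 ∈ D)
    (hσpos : ∀ t : ℕ, 0 < sigma1 (toMat (f' (X t))))
    (hu1 : ∀ t : ℕ, ‖u1 t‖ = 1) (hv1 : ∀ t : ℕ, ‖v1 t‖ = 1)
    (htop : ∀ t : ℕ, ⟪u1 t, Matrix.toEuclideanCLM (𝕜 := ℝ) (toMat (f' (X t))) (v1 t)⟫
      = -(sigma1 (toMat (f' (X t)))))
    (hu : ∀ t : ℕ, ‖u t‖ = 1) (hv : ∀ t : ℕ, ‖v t‖ = 1)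
    (huerr : ∀ t : ℕ, ‖u t - u1 t‖ ≤ Cf / (2 * ((t : ℝ) + 2) * sigma1 (toMat (f' (X t)))))
    (hverr : ∀ t : ℕ, ‖v t - v1 t‖ ≤ Cf / (2 * ((t : ℝ) + 2) * sigma1 (toMat (f' (X t)))))
    (hupd : ∀ t : ℕ, X (t + 1) = (1 - 2 / ((t : ℝ) + 2)) • X t +
      (2 / ((t : ℝ) + 2)) • outerEuc (u t) (v t)) :
    ∀ t : ℕ, 1 ≤ t → f (X t) - f Xstar ≤ 4 * Cf / ((t : ℝ) + 2) := by
  have hstep : ∀ t : ℕ, 2 / ((t : ℝ) + 2) ∈ Set.Icc (0 : ℝ) 1 := fun t =>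
    ⟨by positivity, by
      rw [div_le_one (by positivity)]
      linarith [t.cast_nonneg (α := ℝ)]⟩
  have hupd' : ∀ t : ℕ,
      X (t + 1) = X t + (2 / ((t : ℝ) + 2)) • (outerEuc (u t) (v t) - X t) := fun t => by
    rw [hupd t]
    module
  have hXD : ∀ t, X t ∈ D := by
    intro t
    induction t with
    | zero => exact hX0
    | succ t ih =>
      rw [hupd' t]
      exact hDcv.add_smul_sub_mem ih (hDouter _ _ (hu t) (hv t)) (hstep t)
  refine le_div_of_frankWolfe_recursion (h := fun t => f (X t) - f Xstar) (by positivity)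
    fun t => ?_
  have horacle : ⟪outerEuc (u t) (v t), f' (X t)⟫
      ≤ -(sigma1 (toMat (f' (X t)))) + Cf / ((t : ℝ) + 2) := by
    rw [inner_outerEuc]
    refine (inner_apply_le_of_unit _ (b := v1 t) (hv t) (hu1 t)).trans ?_
    rw [htop t]
    gcongr
    calc sigma1 (toMat (f' (X t))) * (‖u t - u1 t‖ + ‖v t - v1 t‖)
        ≤ sigma1 (toMat (f' (X t))) *
            (Cf / (2 * ((t : ℝ) + 2) * sigma1 (toMat (f' (X t)))) +
              Cf / (2 * ((t : ℝ) + 2) * sigma1 (toMat (f' (X t))))) :=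
          mul_le_mul_of_nonneg_left (add_le_add (huerr t) (hverr t)) (hσpos t).le
      _ = Cf / ((t : ℝ) + 2) := by
          have hσ := (hσpos t).ne'
          field_simp
          ring
  have hgap : ⟪outerEuc (u t) (v t) - X t, f' (X t)⟫
      ≤ f Xstar - f (X t) + Cf / ((t : ℝ) + 2) := by
    have htangent := hconv.add_inner_gradient_le (hgrad (X t)) Xstar
    rw [inner_sub_left] at htangent ⊢
    linarith [hDlb Xstar hXstar (f' (X t))]
  have hdescent := hcurv (X t) (hXD t) _ (hDouter _ _ (hu t) (hv t)) _ (hstep t)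
  rw [← hupd' t] at hdescent
  calc f (X (t + 1)) - f Xstar
      ≤ f (X t) + 2 / ((t : ℝ) + 2) * (f Xstar - f (X t) + Cf / ((t : ℝ) + 2))
          + (2 / ((t : ℝ) + 2)) ^ 2 / 2 * Cf - f Xstar := by
        linarith [mul_le_mul_of_nonneg_left hgap (hstep t).1]
    _ = (1 - 2 / ((t : ℝ) + 2)) * (f (X t) - f Xstar) + 4 * Cf / ((t : ℝ) + 2) ^ 2 := by
        field_simp
        ring
end

section
/- Let x, s ∈ D, γ ∈ [0,1], c ≥ 0, and suppose ⟨s, ∇f(x)⟩ ≤ min_{ŝ ∈ D} ⟨ŝ, ∇f(x)⟩ + c. Set x⁺ = (1 − γ)·x + γ·s and h(z) = f(z) − f(x*). Then h(x⁺) ≤ (1 − γ)·h(x) + γ·c + (γ²/2)·C_f. -/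
open scoped RealInnerProductSpace

/-- The first-order characterization of convexity: a convex function lies above its tangent
hyperplanes. -/
theorem ConvexOn.add_inner_le_of_hasGradientAt {E : Type*} [NormedAddCommGroup E]
    [InnerProductSpace ℝ E] [CompleteSpace E] {S : Set E} {f : E → ℝ} {g x y : E}
    (hf : ConvexOn ℝ S f) (hx : x ∈ S) (hy : y ∈ S) (hg : HasGradientAt f g x) :
    f x + ⟪y - x, g⟫ ≤ f y := by
  have hline : HasDerivAt (f ∘ AffineMap.lineMap (k := ℝ) x y) ⟪g, y - x⟫ 0 := by
    have hfx : HasFDerivAt f (InnerProductSpace.toDual ℝ E g)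
        (AffineMap.lineMap (k := ℝ) x y 0) := by
      simpa using hg.hasFDerivAt
    simpa using hfx.comp_hasDerivAt (0 : ℝ) AffineMap.hasDerivAt_lineMap
  have hslope := (hf.comp_affineMap (AffineMap.lineMap x y)).le_slope_of_hasDerivAt
    (by simpa using hx) (by simpa using hy) zero_lt_one hline
  simp only [slope_def_field, Function.comp_apply, AffineMap.lineMap_apply_zero,
    AffineMap.lineMap_apply_one, sub_zero, div_one] at hslope
  rw [real_inner_comm]
  linarith

theorem frank_wolfe_single_step_descent {d : ℕ}
    (f : EuclideanSpace ℝ (Fin d) → ℝ)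
    (f' : EuclideanSpace ℝ (Fin d) → EuclideanSpace ℝ (Fin d))
    (D : Set (EuclideanSpace ℝ (Fin d)))
    (hDne : D.Nonempty) (hDcp : IsCompact D) (hDcv : Convex ℝ D)
    (hconv : ConvexOn ℝ Set.univ f)
    (hgrad : ∀ z, HasGradientAt f (f' z) z)
    (Cf : ℝ) (hCf : 0 ≤ Cf)
    (hcurv : ∀ z ∈ D, ∀ w ∈ D, ∀ β ∈ Set.Icc (0:ℝ) 1,
      f (z + β • (w - z)) ≤ f z + β * ⟪w - z, f' z⟫ + β ^ 2 / 2 * Cf)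
    (xstar : EuclideanSpace ℝ (Fin d)) (hxstar : xstar ∈ D)
    (hmin : ∀ z ∈ D, f xstar ≤ f z)
    (x s : EuclideanSpace ℝ (Fin d)) (hx : x ∈ D) (hs : s ∈ D)
    (γ c : ℝ) (hγ : γ ∈ Set.Icc (0:ℝ) 1) (hc : 0 ≤ c)
    (hlin : ∀ shat ∈ D, ⟪s, f' x⟫ ≤ ⟪shat, f' x⟫ + c) :
    f ((1 - γ) • x + γ • s) - f xstar
      ≤ (1 - γ) * (f x - f xstar) + γ * c + γ ^ 2 / 2 * Cf := by
  have hstep := hcurv x hx s hs γ hγ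
  have htangent := hconv.add_inner_le_of_hasGradientAt (Set.mem_univ x) (Set.mem_univ xstar)
    (hgrad x)
  have hgap := hlin xstar hxstar
  rw [inner_sub_left] at hstep htangent
  have hdir : γ * (⟪s, f' x⟫ - ⟪x, f' x⟫) ≤ γ * (f xstar - f x + c) :=
    mul_le_mul_of_nonneg_left (by linarith) hγ.1
  have hpoint : (1 - γ) • x + γ • s = x + γ • (s - x) := by module
  rw [hpoint]
  linarith
end
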